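/- arXiv:math/0412263 — 2 statements merged into one kernel-verified Lean document; each statement's English description precedes it below -/
import Mathlib

section
/- Let G be an infinite, locally finite, connected simple graph and U : E → ℝ injective. Then an edge e belongs to the wired minimal spanning forest F_w(U) if and only if there exists a finite set of vertices W ⊆ V such that e ∈ ∂_E W and U(e) ≤ U(e') for every e' ∈ ∂_E W, i.e., e is the least edge joining W to V \ W. -/
open SimpleGraph

/-- The set of edges of `G` whose endpoints cannot be joined by a path all of whose
edges have strictly smaller label: the (free) minimal spanning forest / tree of `G`. -/
def mstEdges {V α : Type*} [LinearOrder α] (G : SimpleGraph V) (U : Sym2 V → α) :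
    Set (Sym2 V) :=
  {e | e ∈ G.edgeSet ∧ ∀ a b : V, e = s(a, b) →
    ∀ p : G.Walk a b, p.IsPath → ∃ f ∈ p.edges, U e ≤ U f}

/-- A one-sided infinite simple path in `G`. -/
def IsRay {V : Type*} (G : SimpleGraph V) (r : ℕ → V) : Prop :=
  Function.Injective r ∧ ∀ n : ℕ, G.Adj (r n) (r (n + 1))

/-- The edges of a one-sided infinite path. -/
def rayEdges {V : Type*} (r : ℕ → V) : Set (Sym2 V) :=
  Set.range fun n : ℕ => s(r n, r (n + 1))

/-- The wired minimal spanning forest of `G`: edges such that every extended path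
(finite simple path, or pair of disjoint rays from the two endpoints) joining the
endpoints contains an edge of label at least as large. -/
def wmsfEdges {V : Type*} (G : SimpleGraph V) (U : Sym2 V → ℝ) : Set (Sym2 V) :=
  {e | e ∈ G.edgeSet ∧ ∀ a b : V, e = s(a, b) →
    (∀ p : G.Walk a b, p.IsPath → ∃ f ∈ p.edges, U e ≤ U f) ∧
    (∀ r₁ r₂ : ℕ → V, IsRay G r₁ → IsRay G r₂ → r₁ 0 = a → r₂ 0 = b →
      (∀ m n : ℕ, r₁ m ≠ r₂ n) →
      ∃ f ∈ rayEdges r₁ ∪ rayEdges r₂, U e ≤ U f)}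

/-- The edges of `G` joining `W` to its complement. -/
def cutEdges {V : Type*} (G : SimpleGraph V) (W : Set V) : Set (Sym2 V) :=
  {e | e ∈ G.edgeSet ∧ ∃ a b : V, e = s(a, b) ∧ a ∈ W ∧ b ∉ W}

/-- A bi-infinite simple path in `G`. -/
def IsBiRay {V : Type*} (G : SimpleGraph V) (r : ℤ → V) : Prop :=
  Function.Injective r ∧ ∀ n : ℤ, G.Adj (r n) (r (n + 1))

/-- The edges of a bi-infinite simple path. -/
def biRayEdges {V : Type*} (r : ℤ → V) : Set (Sym2 V) :=
  Set.range fun n : ℤ => s(r n, r (n + 1))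

/-- Infinitely many vertices lie behind `v` on geodesics from `a`. -/
def HasInfiniteGeodesicBranch {V : Type*} (H : SimpleGraph V) (a v : V) : Prop :=
  H.Reachable a v ∧ {w | H.Reachable v w ∧ H.dist a w = H.dist a v + H.dist v w}.Infinite

theorem HasInfiniteGeodesicBranch.exists_adj {V : Type*} {H : SimpleGraph V} {a v : V}
    (hv : HasInfiniteGeodesicBranch H a v) (hlf : (H.neighborSet v).Finite) :
    ∃ v', H.Adj v v' ∧ H.dist a v' = H.dist a v + 1 ∧ HasInfiniteGeodesicBranch H a v' := by
  obtain ⟨hav, hinf⟩ := hv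
  by_contra! hcon
  refine hinf (((hlf.subset (Set.sep_subset _ fun v' => H.dist a v' = H.dist a v + 1)).biUnion
    (t := fun v' => {w | H.Reachable v' w ∧ H.dist a w = H.dist a v' + H.dist v' w})
    fun v' hv' => ?_).union (Set.finite_singleton v) |>.subset ?_)
  · have := hcon v' hv'.1 hv'.2
    by_contra hfin
    exact this ⟨hav.trans (SimpleGraph.Adj.reachable hv'.1), hfin⟩
  · rintro w ⟨hvw, hw⟩
    obtain ⟨p, hp⟩ := hvw.exists_walk_length_eq_dist
    cases p with
    | nil => exact Or.inr rfl
    | @cons _ v' _ h p =>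
      obtain ⟨q, hq⟩ := hav.exists_walk_length_eq_dist
      obtain ⟨q', hq'⟩ := (hav.trans h.reachable).exists_walk_length_eq_dist
      obtain ⟨p', hp'⟩ := p.reachable.exists_walk_length_eq_dist
      have h1 := SimpleGraph.dist_le (q.concat h)
      have h2 := SimpleGraph.dist_le (q'.append p')
      have h3 := SimpleGraph.dist_le p
      simp only [SimpleGraph.Walk.length_concat, SimpleGraph.Walk.length_append,
        SimpleGraph.Walk.length_cons] at h1 h2 hp
      refine Or.inl (Set.mem_biUnion (x := v') ⟨h, ?_⟩ ⟨p.reachable, ?_⟩) <;> omega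

/-- **The Kőnig lemma**: an infinite component of a locally finite graph contains a ray from
each of its vertices. -/
theorem exists_isRay_of_infinite_reachable {V : Type*} {H : SimpleGraph V}
    (hlf : ∀ v, (H.neighborSet v).Finite) {a : V} (hinf : {w | H.Reachable a w}.Infinite) :
    ∃ r, IsRay H r ∧ r 0 = a := by
  choose! next hadj hdist hnext using
    fun v (hv : HasInfiniteGeodesicBranch H a v) => hv.exists_adj (hlf v)
  have h0 : HasInfiniteGeodesicBranch H a a := ⟨.rfl, by simpa using hinf⟩
  have hgood (n : ℕ) : HasInfiniteGeodesicBranch H a (next^[n] a) := by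
    induction n with
    | zero => exact h0
    | succ n ih => rw [Function.iterate_succ_apply']; exact hnext _ ih
  have hd (n : ℕ) : H.dist a (next^[n] a) = n := by
    induction n with
    | zero => simp
    | succ n ih => rw [Function.iterate_succ_apply', hdist _ (hgood n), ih]
  refine ⟨fun n => next^[n] a, ⟨fun m n h => ?_, fun n => ?_⟩, rfl⟩
  · rw [← hd m, ← hd n]
    exact congrArg _ h
  · simpa only [Function.iterate_succ_apply'] using hadj _ (hgood n)

theorem IsRay.reachable {V : Type*} {H : SimpleGraph V} {r : ℕ → V} (hr : IsRay H r) (n : ℕ) :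
    H.Reachable (r 0) (r n) := by
  induction n with
  | zero => exact .rfl
  | succ n ih => exact ih.trans (hr.2 n).reachable

theorem mem_cutEdges_of_adj {V : Type*} {G : SimpleGraph V} {W : Set V} {x y : V}
    (h : G.Adj x y) (hx : x ∈ W) (hy : y ∉ W) : s(x, y) ∈ cutEdges G W :=
  ⟨h, x, y, rfl, hx, hy⟩

theorem exists_mem_edges_mem_cutEdges {V : Type*} {G : SimpleGraph V} {W : Set V} {a b : V}
    (p : G.Walk a b) (h : a ∈ W ↔ b ∉ W) : ∃ f ∈ p.edges, f ∈ cutEdges G W := by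
  by_cases ha : a ∈ W
  · obtain ⟨d, hd, h1, h2⟩ := p.exists_boundary_dart W ha (h.1 ha)
    exact ⟨d.edge, List.mem_map_of_mem hd, mem_cutEdges_of_adj d.adj h1 h2⟩
  · obtain ⟨d, hd, h1, h2⟩ := p.exists_boundary_dart Wᶜ ha (by tauto)
    refine ⟨d.edge, List.mem_map_of_mem hd, ?_⟩
    rw [← d.edge_symm]
    exact mem_cutEdges_of_adj d.adj.symm (not_not.1 h2) h1

/-- A ray starting in a finite set leaves it. -/
theorem IsRay.exists_mem_rayEdges_mem_cutEdges {V : Type*} {G : SimpleGraph V} {W : Set V}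
    {r : ℕ → V} (hr : IsRay G r) (hW : W.Finite) (h0 : r 0 ∈ W) :
    ∃ f ∈ rayEdges r, f ∈ cutEdges G W := by
  by_contra! hcon
  have hall (n : ℕ) : r n ∈ W := by
    induction n with
    | zero => exact h0
    | succ n ih =>
      by_contra hn
      exact hcon _ ⟨n, rfl⟩ (mem_cutEdges_of_adj (hr.2 n) ih hn)
  exact Set.infinite_of_injective_forall_mem hr.1 hall hW

theorem mem_wmsfEdges_of_isLeast_cutEdges {V : Type*} {G : SimpleGraph V} {U : Sym2 V → ℝ}
    {e : Sym2 V} {W : Set V} (hW : W.Finite) (he : e ∈ cutEdges G W)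
    (hmin : ∀ f ∈ cutEdges G W, U e ≤ U f) : e ∈ wmsfEdges G U := by
  obtain ⟨heG, x, y, hxy, hx, hy⟩ := he
  refine ⟨heG, fun a b hab => ?_⟩
  have hor : a ∈ W ∧ b ∉ W ∨ b ∈ W ∧ a ∉ W := by
    rcases Sym2.eq_iff.1 (hab.symm.trans hxy) with ⟨rfl, rfl⟩ | ⟨rfl, rfl⟩
    · exact .inl ⟨hx, hy⟩
    · exact .inr ⟨hx, hy⟩
  constructor
  · intro p _
    obtain ⟨f, hf, hfc⟩ := exists_mem_edges_mem_cutEdges (W := W) p (by tauto)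
    exact ⟨f, hf, hmin f hfc⟩
  · rintro r₁ r₂ h₁ h₂ rfl rfl -
    rcases hor with ⟨h, -⟩ | ⟨h, -⟩
    · obtain ⟨f, hf, hfc⟩ := h₁.exists_mem_rayEdges_mem_cutEdges hW h
      exact ⟨f, .inl hf, hmin f hfc⟩
    · obtain ⟨f, hf, hfc⟩ := h₂.exists_mem_rayEdges_mem_cutEdges hW h
      exact ⟨f, .inr hf, hmin f hfc⟩

/-- The spanning subgraph of `G` formed by the edges of label less than `c`. -/
def subgraphBelow {V : Type*} (G : SimpleGraph V) (U : Sym2 V → ℝ) (c : ℝ) : SimpleGraph V where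
  Adj x y := G.Adj x y ∧ U s(x, y) < c
  symm := ⟨fun x y h => ⟨h.1.symm, by rw [Sym2.eq_swap]; exact h.2⟩⟩
  loopless := ⟨fun x h => h.1.ne rfl⟩

theorem subgraphBelow_le {V : Type*} (G : SimpleGraph V) (U : Sym2 V → ℝ) (c : ℝ) :
    subgraphBelow G U c ≤ G :=
  fun _ _ h => h.1

theorem lt_of_mem_edgeSet_subgraphBelow {V : Type*} {G : SimpleGraph V} {U : Sym2 V → ℝ} {c : ℝ}
    {f : Sym2 V} (hf : f ∈ (subgraphBelow G U c).edgeSet) : U f < c := by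
  induction f with
  | _ x y => exact hf.2

theorem le_of_mem_cutEdges_component {V : Type*} {G : SimpleGraph V} {U : Sym2 V → ℝ} {c : ℝ}
    {a : V} {f : Sym2 V} (hf : f ∈ cutEdges G {w | (subgraphBelow G U c).Reachable a w}) :
    c ≤ U f := by
  obtain ⟨hfG, x, y, rfl, hx, hy⟩ := hf
  by_contra! hlt
  have hxy : (subgraphBelow G U c).Adj x y := ⟨hfG, hlt⟩
  exact hy (SimpleGraph.Reachable.trans hx hxy.reachable)

theorem IsRay.mono {V : Type*} {H G : SimpleGraph V} (h : H ≤ G) {r : ℕ → V} (hr : IsRay H r) :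
    IsRay G r :=
  ⟨hr.1, fun n => h (hr.2 n)⟩

theorem IsRay.rayEdges_subset {V : Type*} {G : SimpleGraph V} {r : ℕ → V} (hr : IsRay G r) :
    rayEdges r ⊆ G.edgeSet := by
  rintro _ ⟨n, rfl⟩
  exact hr.2 n

theorem exists_finite_isLeast_cutEdges {V : Type*} {G : SimpleGraph V}
    (hlf : ∀ v, (G.neighborSet v).Finite) {U : Sym2 V → ℝ} {e : Sym2 V}
    (he : e ∈ wmsfEdges G U) :
    ∃ W : Set V, W.Finite ∧ e ∈ cutEdges G W ∧ ∀ f ∈ cutEdges G W, U e ≤ U f := by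
  classical
  obtain ⟨heG, hext⟩ := he
  induction e with
  | _ a b =>
    obtain ⟨hpath, hray⟩ := hext a b rfl
    set H := subgraphBelow G U (U s(a, b))
    have hle : H ≤ G := subgraphBelow_le _ _ _
    have hHlf (v : V) : (H.neighborSet v).Finite := (hlf v).subset fun w hw => hle hw
    have hab : ¬ H.Reachable a b := by
      rintro ⟨p⟩
      obtain ⟨f, hf, hUf⟩ := hpath (p.toPath.1.mapLe hle) (p.toPath.2.mapLe hle)
      rw [SimpleGraph.Walk.edges_mapLe_eq_edges] at hf
      exact hUf.not_gt (lt_of_mem_edgeSet_subgraphBelow (p.toPath.1.edges_subset_edgeSet hf))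
    by_cases hafin : {w | H.Reachable a w}.Finite
    · exact ⟨_, hafin, mem_cutEdges_of_adj heG (.refl a) hab,
        fun f hf => le_of_mem_cutEdges_component hf⟩
    by_cases hbfin : {w | H.Reachable b w}.Finite
    · refine ⟨_, hbfin, ?_, fun f hf => le_of_mem_cutEdges_component hf⟩
      rw [Sym2.eq_swap]
      exact mem_cutEdges_of_adj (G.adj_symm heG) (.refl b) fun h => hab h.symm
    obtain ⟨r₁, hr₁, h₁⟩ := exists_isRay_of_infinite_reachable hHlf hafin
    obtain ⟨r₂, hr₂, h₂⟩ := exists_isRay_of_infinite_reachable hHlf hbfin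
    obtain ⟨f, hf, hUf⟩ := hray r₁ r₂ (hr₁.mono hle) (hr₂.mono hle) h₁ h₂ fun m n h =>
      hab (h₁ ▸ h₂ ▸ (hr₁.reachable m).trans (h ▸ (hr₂.reachable n).symm))
    exact absurd (lt_of_mem_edgeSet_subgraphBelow
      (Set.union_subset hr₁.rayEdges_subset hr₂.rayEdges_subset hf)) hUf.not_gt

/-- In an infinite, locally finite, connected graph with injective edge
labels, an edge belongs to the wired minimal spanning forest iff it is the least
edge of the cut determined by some finite vertex set. -/
theorem stmt8 {V : Type*} [Infinite V] (G : SimpleGraph V)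
    (hlf : ∀ v : V, (G.neighborSet v).Finite) (hG : G.Connected)
    (U : Sym2 V → ℝ) (hU : Set.InjOn U G.edgeSet) (e : Sym2 V) :
    e ∈ wmsfEdges G U ↔
      ∃ W : Set V, W.Finite ∧ e ∈ cutEdges G W ∧ ∀ f ∈ cutEdges G W, U e ≤ U f := by
  exact ⟨exists_finite_isLeast_cutEdges hlf,
    fun ⟨_, hW, he, hmin⟩ => mem_wmsfEdges_of_isLeast_cutEdges hW he hmin⟩
end

section
/- Let H be a graph of bounded degree that contains no bi-infinite simple path, and let p ∈ [0,1). Then under Bernoulli(p) bond percolation on H (each edge independently retained with probability p, deleted with probability 1−p, with respect to the product of Bernoulli(p) measures on {0,1}^{E(H)}), almost surely every connected component of the retained subgraph is finite. In other words, p_c(H) = 1. -/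
open SimpleGraph

open MeasureTheory

/-- A compactness principle: binary constraints on a function with values in finite sets can be
satisfied simultaneously as soon as they can be satisfied up to every level. -/
theorem exists_forall_of_forall_level {ι V : Type*} (B : ι → Set V) (hB : ∀ i, (B i).Finite)
    (N : ι → ℕ) (R : ι → ι → V → V → Prop)
    (h : ∀ m : ℕ, ∃ f : ι → V, (∀ i, f i ∈ B i) ∧
      ∀ i j, N i ≤ m → N j ≤ m → R i j (f i) (f j)) :
    ∃ f : ι → V, ∀ i j, R i j (f i) (f j) := by
  let _ : TopologicalSpace V := ⊥
  have : DiscreteTopology V := ⟨rfl⟩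
  let K : ℕ → Set (ι → V) := fun m =>
    Set.univ.pi B ∩ ⋂ i, ⋂ j, {f | N i ≤ m → N j ≤ m → R i j (f i) (f j)}
  have hpi : IsCompact (Set.univ.pi B) := isCompact_univ_pi fun i => (hB i).isCompact
  have hcl : ∀ m, IsClosed (⋂ i, ⋂ j, {f : ι → V | N i ≤ m → N j ≤ m → R i j (f i) (f j)}) := by
    intro m
    refine isClosed_iInter fun i => isClosed_iInter fun j => ?_
    have hc : Continuous fun f : ι → V => (f i, f j) := by fun_prop
    exact (isClosed_discrete {q : V × V | N i ≤ m → N j ≤ m → R i j q.1 q.2}).preimage hc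
  have hne : (⋂ m, K m).Nonempty := by
    refine IsCompact.nonempty_iInter_of_sequence_nonempty_isCompact_isClosed K ?_ ?_ ?_ ?_
    · intro m f hf
      refine ⟨hf.1, ?_⟩
      have h2 := hf.2
      simp only [Set.mem_iInter, Set.mem_ofPred_eq] at h2 ⊢
      exact fun i j hi hj => h2 i j (by omega) (by omega)
    · intro m
      obtain ⟨f, hf1, hf2⟩ := h m
      exact ⟨f, fun i _ => hf1 i, by simpa only [Set.mem_iInter, Set.mem_ofPred_eq] using hf2⟩
    · exact hpi.inter_right (hcl 0)
    · exact fun m => (hpi.isClosed).inter (hcl m)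
  obtain ⟨f, hf⟩ := hne
  refine ⟨f, fun i j => ?_⟩
  have h2 := (Set.mem_iInter.1 hf (max (N i) (N j))).2
  simp only [Set.mem_iInter, Set.mem_ofPred_eq] at h2
  exact h2 i j (le_max_left _ _) (le_max_right _ _)

/-- The vertices joined to `w` by a walk of length at most `n`. -/
def walkBall {V : Type*} (G : SimpleGraph V) (w : V) (n : ℕ) : Set V :=
  {z | ∃ q : G.Walk w z, q.length ≤ n}

theorem walkBall_finite {V : Type*} {G : SimpleGraph V} (hlf : ∀ v, (G.neighborSet v).Finite)
    (w : V) (n : ℕ) : (walkBall G w n).Finite := by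
  induction n generalizing w with
  | zero =>
    refine (Set.finite_singleton w).subset ?_
    rintro z ⟨q, hq⟩
    exact (Walk.eq_of_length_eq_zero (Nat.le_zero.1 hq)).symm
  | succ n ih =>
    refine ((Set.finite_singleton w).union ((hlf w).biUnion fun u _ => ih u)).subset ?_
    rintro z ⟨q, hq⟩
    cases q with
    | nil => exact Or.inl rfl
    | cons h q =>
      refine Or.inr (Set.mem_biUnion h ⟨q, ?_⟩)
      simpa using hq

theorem getVert_mem_walkBall {V : Type*} {G : SimpleGraph V} {w z : V} (q : G.Walk w z) (n : ℕ) :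
    q.getVert n ∈ walkBall G w n :=
  ⟨q.take n, by simp⟩

/-- König's lemma for locally finite graphs. -/
theorem exists_isRay_of_infinite {V : Type*} {G : SimpleGraph V}
    (hlf : ∀ v, (G.neighborSet v).Finite) {a : V} (h : {z | G.Reachable a z}.Infinite) :
    ∃ r : ℕ → V, IsRay G r ∧ r 0 = a := by
  classical
  obtain ⟨r, hr⟩ := exists_forall_of_forall_level (walkBall G a) (walkBall_finite hlf a) id
    (fun i j u v => (u = v → i = j) ∧ (j = i + 1 → G.Adj u v) ∧ (i = 0 → u = a)) (fun m => by
      obtain ⟨z, ⟨q⟩, hz⟩ := h.exists_notMem_finite (walkBall_finite hlf a m)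
      have hlen : m < q.bypass.length := not_le.1 fun hle => hz ⟨_, hle⟩
      have hinj := (q.bypass_isPath).getVert_injOn
      refine ⟨q.bypass.getVert, getVert_mem_walkBall _, fun i j hi hj => ⟨?_, ?_, ?_⟩⟩
      · exact fun he => hinj (le_trans hi hlen.le) (le_trans hj hlen.le) he
      · rintro rfl
        exact q.bypass.adj_getVert_succ (lt_of_le_of_lt hi hlen)
      · rintro rfl
        simp)
  exact ⟨r, ⟨fun i j he => (hr i j).1 he, fun n => (hr n (n + 1)).2.1 rfl⟩, (hr 0 0).2.2 rfl⟩

/-- Arbitrarily long pairs of paths meeting only at their origin yield a bi-infinite path. -/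
theorem exists_isBiRay_of_forall_long {V : Type*} {G : SimpleGraph V}
    (hlf : ∀ v, (G.neighborSet v).Finite) (w : V)
    (h : ∀ m : ℕ, ∃ (x : V) (P Q : G.Walk w x), P.IsPath ∧ Q.IsPath ∧
      m < P.length ∧ m < Q.length ∧ ∀ u, u ∈ P.support → u ∈ Q.support → u = w ∨ u = x) :
    ∃ r : ℤ → V, IsBiRay G r := by
  obtain ⟨r, hr⟩ := exists_forall_of_forall_level (fun i : ℤ => walkBall G w i.natAbs)
    (fun i => walkBall_finite hlf w _) Int.natAbs
    (fun i j u v => (u = v → i = j) ∧ (j = i + 1 → G.Adj u v)) (fun m => by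
      obtain ⟨x, P, Q, hP, hQ, hPm, hQm, hPQ⟩ := h m
      have hPi : ∀ i j : ℕ, i ≤ m → j ≤ m → P.getVert i = P.getVert j → i = j :=
        fun i j hi hj he => hP.getVert_injOn (hi.trans hPm.le) (hj.trans hPm.le) he
      have hQi : ∀ i j : ℕ, i ≤ m → j ≤ m → Q.getVert i = Q.getVert j → i = j :=
        fun i j hi hj he => hQ.getVert_injOn (hi.trans hQm.le) (hj.trans hQm.le) he
      have hcross : ∀ i j : ℕ, i ≤ m → j ≤ m → P.getVert i = Q.getVert j → i = 0 ∧ j = 0 := by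
        intro i j hi hj he
        rcases hPQ _ (P.getVert_mem_support i) (he ▸ Q.getVert_mem_support j) with h1 | h1
        · exact ⟨hPi i 0 hi (Nat.zero_le _) (by simpa using h1),
            hQi j 0 hj (Nat.zero_le _) (by simpa [← he] using h1)⟩
        · have h2 : P.getVert i = P.getVert P.length := by rw [h1, P.getVert_length]
          have h3 := hP.getVert_injOn (hi.trans hPm.le) (le_refl P.length) h2
          omega
      refine ⟨fun i => if 0 ≤ i then P.getVert i.natAbs else Q.getVert i.natAbs, ?_, ?_⟩
      · intro i
        dsimp only
        split_ifs
        · exact getVert_mem_walkBall _ _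
        · exact getVert_mem_walkBall _ _
      · intro i j hi hj
        dsimp only
        refine ⟨?_, ?_⟩
        · intro he
          split_ifs at he with h1 h2 h2
          · have := hPi _ _ hi hj he
            omega
          · have := hcross _ _ hi hj he
            omega
          · have := hcross _ _ hj hi he.symm
            omega
          · have := hQi _ _ hi hj he
            omega
        · rintro rfl
          split_ifs with h1 h2 h2
          · have h3 : (i + 1).natAbs = i.natAbs + 1 := by omega
            rw [h3]
            exact P.adj_getVert_succ (by omega)
          · omega
          · obtain rfl : i = -1 := by omega
            have := Q.adj_getVert_succ (i := 0) (by omega)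
            simpa using this.symm
          · have h3 : i.natAbs = (i + 1).natAbs + 1 := by omega
            rw [h3]
            exact (Q.adj_getVert_succ (by omega)).symm)
  exact ⟨r, fun i j he => (hr i j).1 he, fun n => (hr n (n + 1)).2 rfl⟩

/-- Two disjoint rays with adjacent origins form a bi-infinite path. -/
theorem exists_isBiRay_of_disjoint_rays {V : Type*} {G : SimpleGraph V} {r s : ℕ → V}
    (hr : IsRay G r) (hs : IsRay G s) (hadj : G.Adj (s 0) (r 0)) (hd : ∀ m n, r m ≠ s n) :
    ∃ t : ℤ → V, IsBiRay G t := by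
  let t : ℤ → V := fun n => if 0 ≤ n then r n.toNat else s (-n - 1).toNat
  refine ⟨t, ?_, ?_⟩
  · intro i j he
    simp only [t] at he
    split_ifs at he with h1 h2 h2
    · have := hr.1 he
      omega
    · exact absurd he (hd _ _)
    · exact absurd he.symm (hd _ _)
    · have := hs.1 he
      omega
  · intro n
    simp only [t]
    split_ifs with h1 h2 h2
    · have h3 : (n + 1).toNat = n.toNat + 1 := by omega
      rw [h3]
      exact hr.2 _
    · omega
    · obtain rfl : n = -1 := by omega
      simpa using hadj
    · have h3 : (-n - 1).toNat = (-(n + 1) - 1).toNat + 1 := by omega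
      rw [h3]
      exact (hs.2 _).symm

/-- Two walks of `G` out of `w` to `x` that are paths and meet only at their ends. -/
def HasFan {V : Type*} (G : SimpleGraph V) (w x : V) : Prop :=
  ∃ P Q : G.Walk w x, P.IsPath ∧ Q.IsPath ∧
    ∀ u, u ∈ P.support → u ∈ Q.support → u = w ∨ u = x

theorem exists_walk_leaving {V : Type*} {G : SimpleGraph V} (A : Set V) {u v : V}
    (S : G.Walk u v) (h : ∃ a ∈ S.support, a ∈ A) :
    ∃ (z : V) (T : G.Walk z v), z ∈ A ∧ (∀ t ∈ T.support, t ∈ A → t = z) ∧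
      ∀ t ∈ T.support, t ∈ S.support := by
  induction S with
  | nil =>
    obtain ⟨a, ha, haA⟩ := h
    simp only [Walk.support_nil, List.mem_singleton] at ha
    subst ha
    exact ⟨a, .nil, haA, by simp, by simp⟩
  | @cons u u' v hadj S ih =>
    by_cases hS : ∃ a ∈ S.support, a ∈ A
    · obtain ⟨z, T, hz, h1, h2⟩ := ih hS
      exact ⟨z, T, hz, h1, fun t ht => by simp [h2 t ht]⟩
    · push Not at hS
      obtain ⟨a, ha, haA⟩ := h
      rw [Walk.support_cons, List.mem_cons] at ha
      rcases ha with rfl | ha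
      · refine ⟨a, .cons hadj S, haA, fun t ht htA => ?_, fun t ht => ht⟩
        rw [Walk.support_cons, List.mem_cons] at ht
        rcases ht with rfl | ht
        · rfl
        · exact absurd htA (hS t ht)
      · exact absurd haA (hS a ha)

theorem hasFan_of_mem_support {V : Type*} {G : SimpleGraph V} {w x y z : V} (hxy : G.Adj x y)
    (hyw : y ≠ w) (P Q : G.Walk w x) (hP : P.IsPath) (hQ : Q.IsPath)
    (hPQ : ∀ u, u ∈ P.support → u ∈ Q.support → u = w ∨ u = x) (hz : z ∈ P.support)
    (T : G.Walk z y) (hT : ∀ t ∈ T.support, t ∈ P.support ∨ t ∈ Q.support → t = z)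
    (hxT : x ∉ T.support) : HasFan G w y := by
  classical
  have hzx : z ≠ x := fun h => hxT (h ▸ T.start_mem_support)
  have hyQ : y ∉ Q.support := by
    intro hy
    have hyz := hT y T.end_mem_support (Or.inr hy)
    subst hyz
    rcases hPQ _ hz hy with h | h
    · exact hyw h
    · exact hzx h
  refine ⟨((P.takeUntil z hz).append T).bypass, Q.concat hxy, Walk.bypass_isPath _,
    hQ.concat hyQ hxy, fun u hu hu' => ?_⟩
  have hu1 := Walk.support_bypass_subset_support _ hu
  rw [Walk.mem_support_append_iff] at hu1
  rw [Walk.support_concat, List.mem_append, List.mem_singleton] at hu'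
  rcases hu' with hu' | hu'
  · left
    rcases hu1 with h1 | h1
    · rcases hPQ u (P.support_takeUntil_subset_support hz h1) hu' with h2 | h2
      · exact h2
      · subst h2
        exact absurd h1 (Walk.endpoint_notMem_support_takeUntil hP hz hzx.symm)
    · have huz := hT u h1 (Or.inr hu')
      subst huz
      rcases hPQ _ hz hu' with h2 | h2
      · exact h2
      · exact absurd h2 hzx
  · exact Or.inr hu'

/-- The induction step of Whitney's theorem on pairs of internally disjoint paths. -/
theorem HasFan.step {V : Type*} {G : SimpleGraph V} {w x y : V} (h : HasFan G w x)
    (hxy : G.Adj x y) (hyw : y ≠ w) (S : G.Walk w y) (hxS : x ∉ S.support) : HasFan G w y := by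
  obtain ⟨P, Q, hP, hQ, hPQ⟩ := h
  obtain ⟨z, T, hz, hT, hTS⟩ := exists_walk_leaving {t | t ∈ P.support ∨ t ∈ Q.support} S
    ⟨w, S.start_mem_support, Or.inl P.start_mem_support⟩
  have hxT : x ∉ T.support := fun hx => hxS (hTS x hx)
  rcases hz with hz | hz
  · exact hasFan_of_mem_support hxy hyw P Q hP hQ hPQ hz T hT hxT
  · exact hasFan_of_mem_support hxy hyw Q P hQ hP (fun u h1 h2 => hPQ u h2 h1) hz T
      (fun t ht h' => hT t ht h'.symm) hxT

theorem notMem_support_of_deleteIncidenceSet {V : Type*} {G : SimpleGraph V} {x u v : V}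
    (S : (G.deleteIncidenceSet x).Walk u v) (hu : u ≠ x) : x ∉ S.support := by
  induction S with
  | nil => simpa using hu.symm
  | cons h S ih =>
    rw [Walk.support_cons, List.mem_cons, not_or]
    exact ⟨hu.symm, ih (deleteIncidenceSet_adj.1 h).2.2⟩

namespace IsRay

variable {V : Type*} {G : SimpleGraph V} {r : ℕ → V}

theorem drop (hr : IsRay G r) (k : ℕ) : IsRay G fun n => r (k + n) :=
  ⟨fun i j h => by have := hr.1 h; omega, fun n => hr.2 (k + n)⟩

theorem reachable_deleteIncidenceSet (hr : IsRay G r) {x : V} {i j : ℕ} (hij : i ≤ j)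
    (hx : ∀ n, i ≤ n → n ≤ j → r n ≠ x) : (G.deleteIncidenceSet x).Reachable (r i) (r j) := by
  induction j, hij using Nat.le_induction with
  | base => rfl
  | succ j hij ih =>
    refine (ih fun n h1 h2 => hx n h1 (by omega)).trans (Adj.reachable ?_)
    exact deleteIncidenceSet_adj.2 ⟨hr.2 j, hx j hij (by omega), hx (j + 1) (by omega) le_rfl⟩

theorem infinite_reachable (hr : IsRay G r) {x a : V} {i : ℕ} (hx : ∀ n, i ≤ n → r n ≠ x)
    (ha : (G.deleteIncidenceSet x).Reachable a (r i)) :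
    {z | (G.deleteIncidenceSet x).Reachable a z}.Infinite :=
  Set.infinite_of_injective_forall_mem (hr.drop i).1 fun n =>
    ha.trans (hr.reachable_deleteIncidenceSet (Nat.le_add_right i n) fun m hm _ => hx m hm)

/-- If no vertex of a ray but its origin separates the origin from infinity, then without a
bi-infinite path one can bypass every vertex of the ray. -/
theorem bypass (hr : IsRay G r) (hlf : ∀ v, (G.neighborSet v).Finite)
    (hno : ¬ ∃ t : ℤ → V, IsBiRay G t) (n : ℕ)
    (h : {z | (G.deleteIncidenceSet (r (n + 1))).Reachable (r 0) z}.Infinite) :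
    (G.deleteIncidenceSet (r (n + 1))).Reachable (r 0) (r (n + 2)) := by
  by_contra hcon
  have h0 : (G.deleteIncidenceSet (r (n + 1))).Reachable (r 0) (r n) :=
    hr.reachable_deleteIncidenceSet (Nat.zero_le n) fun m _ hm he => by
      have := hr.1 he
      omega
  have hlf' : ∀ v, ((G.deleteIncidenceSet (r (n + 1))).neighborSet v).Finite := fun v =>
    (hlf v).subset fun u hu => (G.deleteIncidenceSet_le _) hu
  obtain ⟨s, hs, hs0⟩ := exists_isRay_of_infinite (a := r n) hlf'
    (h.mono fun z hz => h0.symm.trans hz)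
  have hsreach : ∀ k, (G.deleteIncidenceSet (r (n + 1))).Reachable (r 0) (s k) := by
    intro k
    induction k with
    | zero => rwa [hs0]
    | succ k ih => exact ih.trans (hs.2 k).reachable
  refine hno (exists_isBiRay_of_disjoint_rays (hr.drop (n + 1))
    (s := s) ⟨hs.1, fun k => (G.deleteIncidenceSet_le _) (hs.2 k)⟩ ?_ ?_)
  · rw [hs0]
    exact hr.2 n
  · intro m k he
    rcases Nat.eq_zero_or_pos m with rfl | hm
    · exact (deleteIncidenceSet_adj.1 (hs.2 k)).2.1 he.symm
    · refine hcon ((he ▸ hsreach k : (G.deleteIncidenceSet (r (n + 1))).Reachable (r 0)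
        (r (n + 1 + m))).trans (Reachable.symm ?_))
      refine hr.reachable_deleteIncidenceSet (by omega) fun l hl _ hle => ?_
      have := hr.1 hle
      omega

theorem hasFan (hr : IsRay G r) (hlf : ∀ v, (G.neighborSet v).Finite)
    (hno : ¬ ∃ t : ℤ → V, IsBiRay G t)
    (h : ∀ n, {z | (G.deleteIncidenceSet (r (n + 1))).Reachable (r 0) z}.Infinite) (n : ℕ) :
    HasFan G (r 0) (r (n + 1)) := by
  induction n with
  | zero =>
    have hP : (Walk.cons (hr.2 0) Walk.nil).IsPath := by
      simpa using (hr.2 0).ne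
    exact ⟨_, _, hP, hP, fun u hu _ => by simpa using hu⟩
  | succ n ih =>
    obtain ⟨S⟩ := hr.bypass hlf hno n (h n)
    have hS := notMem_support_of_deleteIncidenceSet S fun he => by
      have := hr.1 he
      omega
    refine ih.step (hr.2 (n + 1)) (fun he => ?_) (S.mapLe (G.deleteIncidenceSet_le _)) ?_
    · have := hr.1 he
      omega
    · simpa using hS

theorem exists_isBiRay (hr : IsRay G r) (hlf : ∀ v, (G.neighborSet v).Finite)
    (h : ∀ n, {z | (G.deleteIncidenceSet (r (n + 1))).Reachable (r 0) z}.Infinite) :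
    ∃ t : ℤ → V, IsBiRay G t := by
  by_contra hno
  refine hno (exists_isBiRay_of_forall_long hlf (r 0) fun m => ?_)
  have hinj : Function.Injective fun n => r (n + 1) := fun i j he => by
    have := hr.1 he
    omega
  obtain ⟨_, ⟨n, rfl⟩, hn⟩ :=
    (Set.infinite_range_of_injective hinj).exists_notMem_finite (walkBall_finite hlf (r 0) m)
  obtain ⟨P, Q, hP, hQ, hPQ⟩ := hr.hasFan hlf hno h n
  exact ⟨_, P, Q, hP, hQ, not_le.1 fun hle => hn ⟨P, hle⟩, not_le.1 fun hle => hn ⟨Q, hle⟩, hPQ⟩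

end IsRay

/-- In a locally finite graph without bi-infinite paths, every vertex of an infinite component is
separated from infinity by infinitely many single vertices. -/
theorem infinite_setOf_separating {V : Type*} {G : SimpleGraph V}
    (hlf : ∀ v, (G.neighborSet v).Finite) (hno : ¬ ∃ t : ℤ → V, IsBiRay G t) {v : V}
    (hv : {z | G.Reachable v z}.Infinite) :
    {x | {z | (G.deleteIncidenceSet x).Reachable v z}.Finite}.Infinite := by
  intro hfin
  obtain ⟨r, hr, rfl⟩ := exists_isRay_of_infinite hlf hv
  set C := {x | {z | (G.deleteIncidenceSet x).Reachable (r 0) z}.Finite} with hC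
  obtain ⟨k, hk⟩ : ∃ k, ∀ j, k < j → r j ∉ C := by
    have hpre : (r ⁻¹' C).Finite := hfin.preimage hr.1.injOn
    obtain ⟨k, hk⟩ := hpre.bddAbove
    exact ⟨k, fun j hj hjC => absurd (hk hjC) (by omega)⟩
  refine hno ((hr.drop k).exists_isBiRay hlf fun n => ?_)
  have hinf : {z | (G.deleteIncidenceSet (r (k + (n + 1)))).Reachable (r 0) z}.Infinite :=
    hk _ (by omega)
  have h0 : (G.deleteIncidenceSet (r (k + (n + 1)))).Reachable (r 0) (r (k + 0)) :=
    hr.reachable_deleteIncidenceSet (by omega) fun m _ hm he => by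
      have := hr.1 he
      omega
  exact hinf.mono fun z hz => h0.symm.trans hz

/-- An infinite set in a locally finite graph contains an infinite sequence of distinct pairwise
nonadjacent vertices. -/
theorem exists_seq_nonadj {V : Type*} {G : SimpleGraph V}
    (hlf : ∀ v, (G.neighborSet v).Finite) {C : Set V} (hC : C.Infinite) :
    ∃ x : ℕ → V, (∀ n, x n ∈ C) ∧ Pairwise fun m n => x m ≠ x n ∧ ¬ G.Adj (x m) (x n) := by
  obtain ⟨x, hx, hx'⟩ := exists_seq_of_forall_finset_exists (· ∈ C)
    (fun a b => a ≠ b ∧ ¬ G.Adj a b) (fun s _ => by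
      obtain ⟨y, hy, hys⟩ := hC.exists_notMem_finite
        (s.finite_toSet.union (s.finite_toSet.biUnion fun a _ => hlf a))
      refine ⟨y, hy, fun a ha => ⟨?_, fun hadj => ?_⟩⟩
      · rintro rfl
        exact hys (Or.inl ha)
      · exact hys (Or.inr (Set.mem_biUnion ha hadj)))
  refine ⟨x, hx, fun m n hmn => ?_⟩
  rcases lt_or_gt_of_ne hmn with h | h
  · exact hx' m n h
  · exact ⟨(hx' n m h).1.symm, fun hadj => (hx' n m h).2 hadj.symm⟩

open Classical in
/-- Under Bernoulli percolation, almost surely all edges at some vertex of a given infinite set are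
closed. -/
theorem ae_exists_closed_star {V : Type*} (H : SimpleGraph V)
    (D : ℕ) (hlf : ∀ v : V, (H.neighborSet v).Finite)
    (hD : ∀ v : V, (H.neighborSet v).ncard ≤ D)
    (p : ℝ) (hp0 : 0 ≤ p) (hp1 : p < 1)
    (μ : Measure (Sym2 V → Bool)) [IsProbabilityMeasure μ]
    (hbern : ∀ (s : Finset (Sym2 V)) (f : Sym2 V → Bool),
      μ {ω : Sym2 V → Bool | ∀ e ∈ s, ω e = f e} =
        ∏ e ∈ s, ENNReal.ofReal (if f e then p else 1 - p))
    {C : Set V} (hC : C.Infinite) :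
    ∀ᵐ ω ∂μ, ∃ x ∈ C, ∀ y, H.Adj x y → ω s(x, y) = false := by
  obtain ⟨x, hxC, hx⟩ := exists_seq_nonadj hlf hC
  let E : V → Finset (Sym2 V) := fun v => (hlf v).toFinset.image fun y => s(v, y)
  have hEdisj : Pairwise fun m n => Disjoint (E (x m)) (E (x n)) := by
    intro m n hmn
    rw [Finset.disjoint_left]
    intro e he he'
    simp only [E, Finset.mem_image, Set.Finite.mem_toFinset, mem_neighborSet] at he he'
    obtain ⟨y, hy, rfl⟩ := he
    obtain ⟨z, hz, hyz⟩ := he'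
    rcases Sym2.eq_iff.1 hyz with ⟨h1, -⟩ | ⟨h1, -⟩
    · exact (hx hmn).1 h1.symm
    · exact (hx hmn).2 (h1 ▸ hy)
  have hEcard : ∀ v, (E v).card ≤ D := fun v =>
    Finset.card_image_le.trans ((Set.ncard_eq_toFinset_card _ (hlf v)).symm.le.trans (hD v))
  have hclosed : ∀ F : Finset (Sym2 V),
      μ {ω : Sym2 V → Bool | ∀ e ∈ F, ω e = false} = ENNReal.ofReal (1 - p) ^ F.card := by
    intro F
    rw [hbern F fun _ => false]
    simp
  let A : ℕ → Set (Sym2 V → Bool) := fun n => {ω | ∀ e ∈ E (x n), ω e = false}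
  have hAmeas : ∀ n, MeasurableSet (A n) := by
    intro n
    have : A n = ⋂ e ∈ E (x n), {ω | ω e = false} := by
      ext ω
      simp [A]
    rw [this]
    exact Finset.measurableSet_biInter _ fun e _ =>
      (measurableSet_singleton false).preimage (measurable_pi_apply e)
  have hindep : ProbabilityTheory.iIndepSet A μ := by
    rw [ProbabilityTheory.iIndepSet_iff_meas_biInter hAmeas]
    intro s
    have : ⋂ n ∈ s, A n = {ω | ∀ e ∈ s.biUnion fun n => E (x n), ω e = false} := by
      ext ω
      simp only [A, Set.mem_iInter, Set.mem_ofPred_eq, Finset.mem_biUnion]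
      grind
    rw [this, hclosed, Finset.card_biUnion fun m _ n _ hmn => hEdisj hmn,
      ← Finset.prod_pow_eq_pow_sum]
    exact Finset.prod_congr rfl fun n _ => (hclosed _).symm
  have hsum : ∑' n, μ (A n) = ⊤ := by
    have hpos : ENNReal.ofReal (1 - p) ^ D ≠ 0 :=
      pow_ne_zero _ (by simpa using hp1)
    have hle : ENNReal.ofReal (1 - p) ≤ 1 := by
      simpa using hp0
    rw [eq_top_iff, ← ENNReal.tsum_const_eq_top_of_ne_zero (α := ℕ) hpos]
    refine ENNReal.tsum_le_tsum fun n => ?_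
    rw [hclosed]
    exact pow_le_pow_right_of_le_one' hle (hEcard _)
  have hlim := ProbabilityTheory.measure_limsup_eq_one hAmeas hindep hsum
  have hae : ∀ᵐ ω ∂μ, ω ∈ Filter.limsup A Filter.atTop :=
    (prob_compl_eq_zero_iff (MeasurableSet.measurableSet_limsup hAmeas)).2 hlim
  filter_upwards [hae] with ω hω
  rw [Filter.mem_limsup_iff_frequently_mem] at hω
  obtain ⟨n, hn⟩ := hω.exists
  exact ⟨x n, hxC n, fun y hy => hn _ (Finset.mem_image_of_mem _ (by simpa using hy))⟩

/-- If `H` has bounded degree and contains no bi-infinite simple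
path, then for any `p ∈ [0,1)`, under Bernoulli(`p`) bond percolation (i.i.d.
retention of edges with probability `p`, expressed through finite-dimensional
marginals of the measure `μ`), almost surely every cluster is finite; that is,
`p_c(H) = 1`. -/
theorem stmt16 {V : Type*} [Countable V] (H : SimpleGraph V)
    (D : ℕ) (hlf : ∀ v : V, (H.neighborSet v).Finite)
    (hD : ∀ v : V, (H.neighborSet v).ncard ≤ D)
    (hnopath : ¬ ∃ r : ℤ → V, IsBiRay H r)
    (p : ℝ) (hp0 : 0 ≤ p) (hp1 : p < 1)
    (μ : Measure (Sym2 V → Bool)) [IsProbabilityMeasure μ]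
    (hbern : ∀ (s : Finset (Sym2 V)) (f : Sym2 V → Bool),
      μ {ω : Sym2 V → Bool | ∀ e ∈ s, ω e = f e} =
        ∏ e ∈ s, ENNReal.ofReal (if f e then p else 1 - p)) :
    μ {ω : Sym2 V → Bool | ∀ v : V,
        {z : V | (SimpleGraph.fromEdgeSet {e | e ∈ H.edgeSet ∧ ω e = true}).Reachable v z}.Finite}
      = 1 := by
  have hae : ∀ᵐ ω ∂μ, ∀ v : V, {z : V | (SimpleGraph.fromEdgeSet
      {e | e ∈ H.edgeSet ∧ ω e = true}).Reachable v z}.Finite := by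
    rw [ae_all_iff]
    intro v
    have hsub : ∀ ω : Sym2 V → Bool,
        SimpleGraph.fromEdgeSet {e | e ∈ H.edgeSet ∧ ω e = true} ≤ H :=
      fun ω a b hab => ((fromEdgeSet_adj _).1 hab).1.1
    by_cases hv : {z | H.Reachable v z}.Finite
    · exact Filter.Eventually.of_forall fun ω => hv.subset fun z hz => hz.mono (hsub ω)
    · filter_upwards [ae_exists_closed_star H D hlf hD p hp0 hp1 μ hbern
        (infinite_setOf_separating hlf hnopath hv)] with ω hω
      obtain ⟨x, hx, hclosed⟩ := hω
      refine Set.Finite.subset hx fun z hz => Reachable.mono (fun a b hab => ?_) hz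
      obtain ⟨⟨hH, hopen⟩, -⟩ := (fromEdgeSet_adj _).1 hab
      refine deleteIncidenceSet_adj.2 ⟨hH, ?_, ?_⟩
      · rintro rfl
        simp [hclosed b hH] at hopen
      · rintro rfl
        rw [Sym2.eq_swap, hclosed a (Adj.symm hH)] at hopen
        exact absurd hopen (by simp)
  rw [← measure_univ (μ := μ)]
  refine measure_congr ?_
  filter_upwards [hae] with ω hω
  exact propext ⟨fun _ => trivial, fun _ => hω⟩
end
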